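/- arXiv:2511.08304 — 2 statements merged into one kernel-verified Lean document; each statement's English description precedes it below -/
import Mathlib

section
/- (Footprint bound.) Let X = A_1 × ⋯ × A_m be a Cartesian set over F_q, let 1 ≤ d ≤ m, and let 1 ≤ r ≤ C(m,d). Then d_r(C_d^{X,S}) ≥ n_1⋯n_m − max{|Δ_X(N)| : N ⊆ S_d(m), |N| = r} = min{|∇_X(N)| : N ⊆ S_d(m), |N| = r}. -/
/-- Square-free exponent vectors of total degree `d` in `m` variables. -/
def Sd (m d : ℕ) : Set (Fin m → ℕ) := {a | (∀ i, a i ≤ 1) ∧ ∑ i, a i = d}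

/-- Square-free exponent vectors of total degree at most `d` in `m` variables. -/
def Sle (m d : ℕ) : Set (Fin m → ℕ) := {a | (∀ i, a i ≤ 1) ∧ ∑ i, a i ≤ d}

/-- Evaluation code over the Cartesian set `X = A 0 × ⋯ × A (m-1)`, spanned by the
evaluations of the monomials `x^a` for `a ∈ S`. -/
noncomputable def evalCodeX {F : Type*} [Field F] {m : ℕ} (A : Fin m → Finset F)
    (S : Set (Fin m → ℕ)) :
    Submodule F ({P : Fin m → F // ∀ i, P i ∈ A i} → F) :=
  Submodule.span F ((fun (a : Fin m → ℕ) (P : {P : Fin m → F // ∀ i, P i ∈ A i}) =>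
    ∏ i, P.1 i ^ a i) '' S)

open Classical in
/-- Support of a linear code. -/
noncomputable def codeSupp {F ι : Type*} [Field F] [Fintype ι]
    (C : Submodule F (ι → F)) : Finset ι :=
  Finset.univ.filter (fun i => ∃ c ∈ C, c i ≠ 0)

/-- The `r`-th generalized Hamming weight of a linear code: the minimum cardinality of the
support of an `r`-dimensional subcode. -/
noncomputable def GHW {F ι : Type*} [Field F] [Fintype ι]
    (C : Submodule F (ι → F)) (r : ℕ) : ℕ :=
  sInf {k | ∃ C' : Submodule F (ι → F),
    C' ≤ C ∧ Module.finrank F C' = r ∧ (codeSupp C').card = k}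

/-- The footprint box `B_X = {0,…,n_1−1} × ⋯ × {0,…,n_m−1}`. -/
noncomputable def BX {F : Type*} {m : ℕ} (A : Fin m → Finset F) : Finset (Fin m → ℕ) :=
  Fintype.piFinset (fun i => Finset.range (A i).card)

open Classical in
/-- The shadow `∇_X(N)`: elements of `B_X` divisible by some element of `N`. -/
noncomputable def nablaX {F : Type*} {m : ℕ} (A : Fin m → Finset F)
    (N : Set (Fin m → ℕ)) : Finset (Fin m → ℕ) :=
  (BX A).filter (fun b => ∃ a ∈ N, ∀ i, a i ≤ b i)

open Classical in
/-- The footprint `Δ_X(N) = B_X ∖ ∇_X(N)`. -/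
noncomputable def deltaX {F : Type*} {m : ℕ} (A : Fin m → Finset F)
    (N : Set (Fin m → ℕ)) : Finset (Fin m → ℕ) :=
  (BX A).filter (fun b => ¬ ∃ a ∈ N, ∀ i, a i ≤ b i)

section Monomials

variable {F ι : Type*} [Field F] {m : ℕ}

/-- The values of the monomial `x^a` at a family of points `p`. -/
def monomialValues (p : ι → Fin m → F) (a : Fin m → ℕ) : ι → F :=
  fun i => ∏ j, p i j ^ a j

theorem monomialValues_add (p : ι → Fin m → F) (a b : Fin m → ℕ) :
    monomialValues p (a + b) = monomialValues p a * monomialValues p b := by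
  ext i
  simp [monomialValues, pow_add, Finset.prod_mul_distrib]

theorem monomialValues_single (p : ι → Fin m → F) (j : Fin m) (k : ℕ) (i : ι) :
    monomialValues p (Pi.single j k) i = p i j ^ k := by
  unfold monomialValues
  rw [Finset.prod_eq_single j]
  · simp
  · intro b _ hb
    simp [hb]
  · simp

/-- Over a finite field, monomials span all functions on a set of distinct points. -/
theorem span_range_monomialValues [Fintype F] {p : ι → Fin m → F} (hp : Function.Injective p) :
    Submodule.span F (Set.range (monomialValues p)) = ⊤ := by
  refine top_unique fun f _ => ?_
  have hg : Function.extend p f 0 ∈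
      (MvPolynomial.restrictDegree (Fin m) F (Fintype.card F - 1)).map
        (MvPolynomial.evalₗ F (Fin m)) := by
    rw [MvPolynomial.map_restrict_dom_evalₗ]
    trivial
  obtain ⟨q, -, hq⟩ := hg
  have hf : f = ∑ e ∈ q.support, q.coeff e • monomialValues p e := by
    ext i
    have h := congrFun hq (p i)
    rw [hp.extend_apply, MvPolynomial.evalₗ_apply, MvPolynomial.eval_eq'] at h
    simp [← h, monomialValues, Finset.sum_apply]
  rw [hf]
  exact Submodule.sum_mem _ fun e _ =>
    Submodule.smul_mem _ _ (Submodule.subset_span ⟨_, rfl⟩)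

/-- On a finite set, the power `x ^ card` is a combination of lower powers. -/
theorem exists_pow_card_eq_sum (A : Finset F) :
    ∃ c : ℕ → F, ∀ x ∈ A, x ^ A.card = ∑ k ∈ Finset.range A.card, c k * x ^ k := by
  classical
  let q : Polynomial F := ∏ a ∈ A, (Polynomial.X - Polynomial.C a)
  have hmonic : q.Monic := Polynomial.monic_prod_of_monic _ _ fun a _ => Polynomial.monic_X_sub_C a
  have hdeg : q.natDegree = A.card := by
    simp [q, Polynomial.natDegree_prod_of_monic, Polynomial.monic_X_sub_C]
  refine ⟨fun k => -q.coeff k, fun x hx => ?_⟩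
  have h0 : q.eval x = 0 := by
    rw [Polynomial.eval_prod]
    exact Finset.prod_eq_zero hx (by simp)
  have hlead : q.coeff A.card = 1 := by rw [← hdeg]; exact hmonic
  rw [Polynomial.eval_eq_sum_range, hdeg, Finset.sum_range_succ, hlead, one_mul] at h0
  simp only [neg_mul, Finset.sum_neg_distrib]
  linear_combination h0

/-- If every `a ∈ N` is the lexicographically leading exponent of a polynomial vanishing on the
given points of the Cartesian set, then the monomials in the footprint of `N` span the span of
all monomials. -/
theorem monomialValues_mem_span_deltaX {A : Fin m → Finset F} {p : ι → Fin m → F}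
    (hA : ∀ i j, p i j ∈ A j) {N : Set (Fin m → ℕ)}
    (hN : ∀ a ∈ N, ∃ w : (Fin m → ℕ) →₀ F, w a ≠ 0 ∧
      (∀ b ∈ w.support, toLex b ≤ toLex a) ∧
      Finsupp.linearCombination F (monomialValues p) w = 0)
    (b : Fin m → ℕ) :
    monomialValues p b ∈ Submodule.span F (monomialValues p '' (deltaX A N : Set (Fin m → ℕ))) := by
  classical
  have wf : WellFounded fun a b : Fin m → ℕ => toLex a < toLex b :=
    InvImage.wf toLex (wellFounded_lt (α := Lex (Fin m → ℕ)))
  induction b using wf.induction with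
  | _ b ih =>
  by_cases hB : b ∈ BX A
  · by_cases hb : ∃ a ∈ N, ∀ i, a i ≤ b i
    · obtain ⟨a, haN, hab⟩ := hb
      obtain ⟨w, hwa, hle, hw⟩ := hN a haN
      obtain ⟨c, rfl⟩ : ∃ c, b = a + c := ⟨b - a, (add_tsub_cancel_of_le hab).symm⟩
      have hsum : w a • monomialValues p (a + c) =
          -∑ e ∈ w.support.erase a, w e • monomialValues p (e + c) := by
        rw [eq_neg_iff_add_eq_zero,
          Finset.add_sum_erase _ (fun e => w e • monomialValues p (e + c))
            (Finsupp.mem_support_iff.2 hwa)]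
        simp only [monomialValues_add, ← smul_mul_assoc, ← Finset.sum_mul]
        rw [Finsupp.linearCombination_apply, Finsupp.sum] at hw
        rw [hw, zero_mul]
      rw [← inv_smul_smul₀ hwa (monomialValues p (a + c)), hsum]
      refine Submodule.smul_mem _ _ (Submodule.neg_mem _ (Submodule.sum_mem _ fun e he =>
        Submodule.smul_mem _ _ (ih _ ?_)))
      rw [Finset.mem_erase] at he
      have hlt : toLex e < toLex a :=
        lt_of_le_of_ne (hle e he.2) fun h => he.1 (toLex.injective h)
      exact add_lt_add_left hlt (toLex c)
    · exact Submodule.subset_span ⟨b, by simp only [deltaX, Finset.coe_filter]; exact ⟨hB, hb⟩, rfl⟩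
  · obtain ⟨j, hj⟩ : ∃ j, (A j).card ≤ b j := by
      simpa [BX, Fintype.mem_piFinset] using hB
    obtain ⟨c, rfl⟩ : ∃ c, b = (Pi.single j (A j).card : Fin m → ℕ) + c := by
      refine ⟨b - Pi.single j (A j).card, (add_tsub_cancel_of_le ?_).symm⟩
      intro i
      rcases eq_or_ne i j with rfl | hij
      · simpa using hj
      · simp [hij]
    obtain ⟨f, hf⟩ := exists_pow_card_eq_sum (A j)
    have hsum : monomialValues p (Pi.single j (A j).card + c) =
        ∑ k ∈ Finset.range (A j).card, f k • monomialValues p (Pi.single j k + c) := by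
      ext i
      simp only [monomialValues_add, Finset.sum_apply, Pi.smul_apply, Pi.mul_apply,
        monomialValues_single, smul_eq_mul, hf _ (hA i j), Finset.sum_mul, mul_assoc]
    rw [hsum]
    refine Submodule.sum_mem _ fun k hk => Submodule.smul_mem _ _ (ih _ ?_)
    have hlt : toLex (Pi.single j k : Fin m → ℕ) < toLex (Pi.single j (A j).card) :=
      Pi.toLex_strictMono (Pi.single_strictMono j (Finset.mem_range.1 hk))
    exact add_lt_add_left hlt (toLex c)

theorem span_monomialValues_deltaX [Fintype F] {A : Fin m → Finset F} {p : ι → Fin m → F}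
    (hp : Function.Injective p) (hA : ∀ i j, p i j ∈ A j) {N : Set (Fin m → ℕ)}
    (hN : ∀ a ∈ N, ∃ w : (Fin m → ℕ) →₀ F, w a ≠ 0 ∧
      (∀ b ∈ w.support, toLex b ≤ toLex a) ∧
      Finsupp.linearCombination F (monomialValues p) w = 0) :
    Submodule.span F (monomialValues p '' (deltaX A N : Set (Fin m → ℕ))) = ⊤ := by
  rw [eq_top_iff, ← span_range_monomialValues hp, Submodule.span_le]
  rintro _ ⟨b, rfl⟩
  exact monomialValues_mem_span_deltaX hA hN b

/-- The number of common zeros is bounded by the size of the footprint. -/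
theorem card_le_card_deltaX [Fintype F] [Fintype ι] {A : Fin m → Finset F} {p : ι → Fin m → F}
    (hp : Function.Injective p) (hA : ∀ i j, p i j ∈ A j) {N : Set (Fin m → ℕ)}
    (hN : ∀ a ∈ N, ∃ w : (Fin m → ℕ) →₀ F, w a ≠ 0 ∧
      (∀ b ∈ w.support, toLex b ≤ toLex a) ∧
      Finsupp.linearCombination F (monomialValues p) w = 0) :
    Fintype.card ι ≤ (deltaX A N).card := by
  classical
  have h := finrank_span_finset_le_card (R := F) ((deltaX A N).image (monomialValues p))
  rw [Set.finrank, Finset.coe_image, span_monomialValues_deltaX hp hA hN, finrank_top,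
    Module.finrank_fintype_fun_eq_card] at h
  exact h.trans Finset.card_image_le

/-- A space of polynomials with finitely many possible exponents has at least as many leading
exponents as its dimension. -/
theorem exists_leading_exponents (S : Finset (Fin m → ℕ))
    (W : Submodule F ((Fin m → ℕ) →₀ F)) (hW : ∀ w ∈ W, w.support ⊆ S) :
    ∃ N ⊆ S, N.card = Module.finrank F W ∧
      ∀ a ∈ N, ∃ w ∈ W, w a ≠ 0 ∧ ∀ b ∈ w.support, toLex b ≤ toLex a := by
  classical
  let L := S.filter fun a => ∃ w ∈ W, w a ≠ 0 ∧ ∀ b ∈ w.support, toLex b ≤ toLex a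
  let T : W →ₗ[F] (L → F) :=
    LinearMap.pi fun a => (Finsupp.lapply (a : Fin m → ℕ)).comp W.subtype
  have hT : Function.Injective T := by
    rw [injective_iff_map_eq_zero]
    intro w hw
    by_contra hne
    have hsupp : (w : (Fin m → ℕ) →₀ F).support.Nonempty := by
      rw [Finsupp.support_nonempty_iff]
      simpa using hne
    obtain ⟨a, ha, hmax⟩ := Finset.exists_max_image _ (toLex (α := Fin m → ℕ)) hsupp
    have haL : a ∈ L := Finset.mem_filter.2
      ⟨hW _ w.2 ha, w, w.2, Finsupp.mem_support_iff.1 ha, hmax⟩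
    exact Finsupp.mem_support_iff.1 ha (congrFun hw ⟨a, haL⟩)
  have hle := LinearMap.finrank_le_finrank_of_injective hT
  rw [Module.finrank_fintype_fun_eq_card, Fintype.card_coe] at hle
  obtain ⟨N, hNL, hN⟩ := Finset.exists_subset_card_eq hle
  exact ⟨N, hNL.trans (Finset.filter_subset _ _), hN,
    fun a ha => (Finset.mem_filter.1 (hNL ha)).2⟩

end Monomials

section Counting

variable {F : Type*} {m : ℕ}

theorem card_BX (A : Fin m → Finset F) : (BX A).card = ∏ i, (A i).card := by
  simp [BX]

theorem card_cartesianSet (A : Fin m → Finset F) [Fintype {P : Fin m → F // ∀ i, P i ∈ A i}] :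
    Fintype.card {P : Fin m → F // ∀ i, P i ∈ A i} = ∏ i, (A i).card := by
  classical
  rw [← Fintype.card_piFinset, ← Fintype.card_coe]
  exact Fintype.card_congr (Equiv.subtypeEquivRight fun P => by simp [Fintype.mem_piFinset])

theorem card_nablaX_add_card_deltaX (A : Fin m → Finset F) (N : Set (Fin m → ℕ)) :
    (nablaX A N).card + (deltaX A N).card = ∏ i, (A i).card := by
  classical
  rw [← card_BX]
  unfold nablaX deltaX
  exact Finset.card_filter_add_card_filter_not _

theorem finite_Sd (m d : ℕ) : (Sd m d).Finite :=
  (Set.finite_Iic (1 : Fin m → ℕ)).subset fun _ ha => ha.1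

theorem exists_finset_subset_Sd {m d r : ℕ} (hr : r ≤ m.choose d) :
    ∃ N : Finset (Fin m → ℕ), ↑N ⊆ Sd m d ∧ N.card = r := by
  classical
  let g : Finset (Fin m) → Fin m → ℕ := fun s i => if i ∈ s then 1 else 0
  have hg : Function.Injective g := by
    intro s t h
    ext i
    have := congrFun h i
    by_cases h1 : i ∈ s <;> by_cases h2 : i ∈ t <;> simp_all [g]
  have hc : r ≤ ((Finset.powersetCard d Finset.univ).image g).card := by
    simpa [Finset.card_image_of_injective _ hg] using hr
  obtain ⟨N, hN, hcard⟩ := Finset.exists_subset_card_eq hc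
  refine ⟨N, fun a ha => ?_, hcard⟩
  obtain ⟨s, hs, rfl⟩ := Finset.mem_image.1 (hN ha)
  refine ⟨fun i => ?_, ?_⟩
  · by_cases h : i ∈ s <;> simp [g, h]
  · simpa [g] using hs

theorem deltaX_empty (A : Fin m → Finset F) : deltaX A ∅ = BX A := by
  simp [deltaX]

/-- The minimum of a complemented quantity is the complement of the maximum. -/
theorem sub_sSup_eq_sInf {α : Type*} {P : α → Prop} {f g : α → ℕ} {n : ℕ}
    (hne : ∃ a, P a) (hfg : ∀ a, f a + g a = n) :
    n - sSup {k | ∃ a, P a ∧ g a = k} = sInf {k | ∃ a, P a ∧ f a = k} := by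
  have hbdd : BddAbove {k | ∃ a, P a ∧ g a = k} := by
    refine ⟨n, ?_⟩
    rintro _ ⟨a, -, rfl⟩
    exact (hfg a).le.trans' (Nat.le_add_left _ _)
  obtain ⟨a₀, ha₀⟩ := hne
  obtain ⟨a, ha, hga⟩ := Nat.sSup_mem (s := {k | ∃ a, P a ∧ g a = k}) ⟨_, a₀, ha₀, rfl⟩ hbdd
  obtain ⟨b, hb, hfb⟩ := Nat.sInf_mem (s := {k | ∃ a, P a ∧ f a = k}) ⟨_, a₀, ha₀, rfl⟩
  have h1 : g b ≤ sSup {k | ∃ a, P a ∧ g a = k} := le_csSup hbdd ⟨b, hb, rfl⟩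
  have h2 : sInf {k | ∃ a, P a ∧ f a = k} ≤ f a := Nat.sInf_le ⟨a, ha, rfl⟩
  have h3 := hfg a
  have h4 := hfg b
  omega

theorem Sd_subset_BX {d : ℕ} {A : Fin m → Finset F} (hcard : ∀ i, 2 ≤ (A i).card) :
    Sd m d ⊆ (BX A : Set (Fin m → ℕ)) := by
  intro a ha
  simp only [BX, Finset.mem_coe, Fintype.mem_piFinset, Finset.mem_range]
  exact fun i => (Nat.lt_succ_of_le (ha.1 i)).trans_le (hcard i)

end Counting

section Codes

variable {F : Type*} [Field F] [Fintype F] {m d : ℕ}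

/-- The monomials with exponents in the box are linearly independent on the Cartesian set. -/
theorem linearIndepOn_monomialValues_BX (A : Fin m → Finset F) :
    LinearIndepOn F (monomialValues fun P : {P : Fin m → F // ∀ i, P i ∈ A i} => P.1)
      (BX A : Set (Fin m → ℕ)) := by
  classical
  refine linearIndependent_of_top_le_span_of_card_eq_finrank ?_ ?_
  · have h := span_monomialValues_deltaX (N := ∅)
      (p := fun P : {P : Fin m → F // ∀ i, P i ∈ A i} => P.1)
      Subtype.val_injective (fun P j => P.2 j) (by simp)
    rw [deltaX_empty, Set.image_eq_range] at h
    exact h.ge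
  · rw [Module.finrank_fintype_fun_eq_card]
    simp only [Finset.coe_sort_coe, Fintype.card_coe]
    rw [card_BX, card_cartesianSet]

theorem exists_subcode_finrank_eq {A : Fin m → Finset F} (hcard : ∀ i, 2 ≤ (A i).card) {r : ℕ}
    (hr : r ≤ m.choose d) :
    ∃ C' ≤ evalCodeX A (Sd m d), Module.finrank F C' = r := by
  obtain ⟨N, hN, rfl⟩ := exists_finset_subset_Sd hr
  refine ⟨evalCodeX A ↑N, Submodule.span_mono (Set.image_mono hN), ?_⟩
  have h := (linearIndepOn_monomialValues_BX A).mono (hN.trans (Sd_subset_BX hcard))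
  have h' := finrank_span_eq_card h
  rw [← Set.image_eq_range] at h'
  exact h'.trans (by simp)

/-- The support of a subcode is at least as large as the shadow of some set of exponents whose
size is the dimension of the subcode. -/
theorem exists_card_nablaX_le_card_codeSupp {A : Fin m → Finset F}
    [Fintype {P : Fin m → F // ∀ i, P i ∈ A i}]
    {C' : Submodule F ({P : Fin m → F // ∀ i, P i ∈ A i} → F)}
    (hC : C' ≤ evalCodeX A (Sd m d)) :
    ∃ N : Finset (Fin m → ℕ), (↑N ⊆ Sd m d ∧ N.card = Module.finrank F C') ∧
      (nablaX A ↑N).card ≤ (codeSupp C').card := by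
  classical
  let p : {P : Fin m → F // ∀ i, P i ∈ A i} → Fin m → F := Subtype.val
  let T := Finsupp.linearCombination F (monomialValues p)
  let W := Finsupp.supported F F (Sd m d) ⊓ C'.comap T
  have hmap : C' ≤ W.map T := by
    intro c hc
    obtain ⟨w, hw, rfl⟩ := (Finsupp.mem_span_image_iff_linearCombination F
      (v := monomialValues p)).1 (hC hc)
    exact ⟨w, ⟨hw, hc⟩, rfl⟩
  have hfinS := finite_Sd m d
  have hWS : ∀ w ∈ W, w.support ⊆ hfinS.toFinset := by
    intro w hw a ha
    exact hfinS.mem_toFinset.2 ((Finsupp.mem_supported F w).1 hw.1 ha)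
  have : Finite (Sd m d) := hfinS
  have : FiniteDimensional F (Finsupp.supported F F (Sd m d)) :=
    Module.Finite.equiv (Finsupp.supportedEquivFinsupp (M := F) (R := F) (Sd m d)).symm
  have : FiniteDimensional F W := Submodule.finiteDimensional_of_le inf_le_left
  have hdim : Module.finrank F C' ≤ Module.finrank F W :=
    (Submodule.finrank_mono hmap).trans (Submodule.finrank_map_le T W)
  obtain ⟨L, hLS, hLcard, hL⟩ := exists_leading_exponents _ W hWS
  obtain ⟨N, hNL, hNcard⟩ := Finset.exists_subset_card_eq (hdim.trans hLcard.ge)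
  refine ⟨N, ⟨fun a ha => hfinS.mem_toFinset.1 (hLS (hNL ha)), hNcard⟩, ?_⟩
  have hzero : (codeSupp C')ᶜ.card ≤ (deltaX A (N : Set (Fin m → ℕ))).card := by
    rw [← Fintype.card_coe]
    refine card_le_card_deltaX (p := fun P : ↥(codeSupp C')ᶜ => p P.1)
      (Subtype.val_injective.comp Subtype.val_injective) (fun P j => P.1.2 j) fun a ha => ?_
    obtain ⟨w, hw, hwa, hle⟩ := hL a (hNL ha)
    refine ⟨w, hwa, hle, ?_⟩
    ext P
    have hP : T w P.1 = 0 := by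
      by_contra hne
      exact Finset.mem_compl.1 P.2 (by
        simp only [codeSupp, Finset.mem_filter, Finset.mem_univ, true_and]
        exact ⟨T w, hw.2, hne⟩)
    simpa [T, Finsupp.linearCombination_apply, Finsupp.sum, Finset.sum_apply,
      monomialValues] using hP
  have hX := card_cartesianSet A
  have h1 := Finset.card_add_card_compl (codeSupp C')
  have h2 := card_nablaX_add_card_deltaX A (N : Set (Fin m → ℕ))
  omega

end Codes

/-- **Footprint bound.** For a Cartesian set `X = A_1 × ⋯ × A_m` over `F_q`,
`1 ≤ d ≤ m` and `1 ≤ r ≤ C(m,d)`, the `r`-th generalized Hamming weight of `C_d^{X,S}`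
is at least `n_1⋯n_m − max{|Δ_X(N)| : N ⊆ S_d(m), |N| = r}`, and this quantity equals
`min{|∇_X(N)| : N ⊆ S_d(m), |N| = r}`. -/
theorem footprint_bound_cartesian_squarefree
    {F : Type*} [Field F] [Fintype F] [DecidableEq F] {m d r : ℕ}
    (A : Fin m → Finset F)
    (hcard : ∀ i, 2 ≤ (A i).card)
    (hmono : ∀ i j : Fin m, i ≤ j → (A i).card ≤ (A j).card)
    (hd1 : 1 ≤ d) (hdm : d ≤ m) (hr1 : 1 ≤ r) (hr2 : r ≤ m.choose d) :
    GHW (evalCodeX A (Sd m d)) r ≥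
      (∏ i, (A i).card) -
        sSup {k | ∃ N : Finset (Fin m → ℕ),
          ↑N ⊆ Sd m d ∧ N.card = r ∧ (deltaX A ↑N).card = k} ∧
    (∏ i, (A i).card) -
        sSup {k | ∃ N : Finset (Fin m → ℕ),
          ↑N ⊆ Sd m d ∧ N.card = r ∧ (deltaX A ↑N).card = k} =
      sInf {k | ∃ N : Finset (Fin m → ℕ),
        ↑N ⊆ Sd m d ∧ N.card = r ∧ (nablaX A ↑N).card = k} := by
  have hne := exists_finset_subset_Sd hr2
  have heq := sub_sSup_eq_sInf hne
    (fun N : Finset (Fin m → ℕ) => card_nablaX_add_card_deltaX A (N : Set (Fin m → ℕ)))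
  simp only [and_assoc] at heq
  refine ⟨?_, heq⟩
  rw [heq, ge_iff_le]
  obtain ⟨C₀, hC₀, hr₀⟩ := exists_subcode_finrank_eq hcard hr2
  refine le_csInf ⟨_, C₀, hC₀, hr₀, rfl⟩ ?_
  rintro _ ⟨C', hC', rfl, rfl⟩
  obtain ⟨N, ⟨hNS, hNr⟩, hle⟩ := exists_card_nablaX_le_card_codeSupp hC'
  refine le_trans (Nat.sInf_le ?_) hle
  exact ⟨N, hNS, hNr, rfl⟩
end

section
/- Let 1 ≤ d ≤ m and 1 ≤ r ≤ m+1−d. Let X = A_1 × ⋯ × A_m be a Cartesian set over F_q with 0 ∈ A_i for all 1 ≤ i ≤ m, and assume that n_{d+r−1}·n_{d−1}·(n_i + n_j − 1) ≤ n_i·n_j·(n_{d+r−1} + n_{d−1} − 1) for every pair of indices d ≤ i < j ≤ d+r−2 (a condition that is vacuous when r ≤ 2). Then d_r(C_d^{X,S}) = ∏_{i=1}^{d−1}(n_i − 1) · ∏_{i=d+r}^{m} n_i · (∏_{i=d}^{d+r−1} n_i − 1). -/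
/-- `nval A k` is the cardinality `n_k = |A_k|`, with the paper's 1-based indexing
(junk value `1` outside the range `1 ≤ k ≤ m`). -/
def nval {F : Type*} {m : ℕ} (A : Fin m → Finset F) (k : ℕ) : ℕ :=
  if h : 1 ≤ k ∧ k ≤ m then (A ⟨k - 1, by omega⟩).card else 1

/-- The weighted size, with weight `∏ i ∈ R, a i` for `R ⊆ {1, …, m}`, of the up-closure of a
family `N` of sets. -/
def upWeight (a : ℕ → ℕ) (m : ℕ) (N : Finset (Finset ℕ)) : ℕ :=
  ∑ R ∈ (Finset.Icc 1 m).powerset with ∃ T ∈ N, T ⊆ R, ∏ i ∈ R, a i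

lemma upWeight_mono (a : ℕ → ℕ) (m : ℕ) {N N' : Finset (Finset ℕ)} (h : N ⊆ N') :
    upWeight a m N ≤ upWeight a m N' := by
  refine Finset.sum_le_sum_of_subset fun R => ?_
  simp only [Finset.mem_filter]
  exact fun ⟨hR, T, hT, hTR⟩ => ⟨hR, T, h hT, hTR⟩

lemma upWeight_succ (a : ℕ → ℕ) (m : ℕ) (N : Finset (Finset ℕ)) :
    upWeight a (m + 1) N =
      upWeight a m N + a (m + 1) * upWeight a m (N.image fun T => T.erase (m + 1)) := by
  have hm : m + 1 ∉ Finset.Icc 1 m := by simp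
  simp only [upWeight, Finset.sum_filter, Finset.mul_sum]
  rw [← Finset.insert_Icc_right_eq_Icc_add_one (by omega : 1 ≤ m + 1),
    Finset.sum_powerset_insert hm]
  congr 1
  refine Finset.sum_congr rfl fun R hR => ?_
  have hmR : m + 1 ∉ R := fun h => hm (Finset.mem_powerset.1 hR h)
  simp only [Finset.exists_mem_image, Finset.prod_insert hmR, mul_ite, mul_zero,
    ← Finset.subset_insert_iff]

lemma upWeight_of_empty_mem (a : ℕ → ℕ) (m : ℕ) {N : Finset (Finset ℕ)} (h : ∅ ∈ N) :
    upWeight a m N = ∏ i ∈ Finset.Icc 1 m, (a i + 1) := by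
  rw [upWeight, Finset.prod_add_one, Finset.filter_true_of_mem]
  exact fun R _ => ⟨∅, h, Finset.empty_subset R⟩

lemma upWeight_erase_add_le (a : ℕ → ℕ) {m d : ℕ} {N : Finset (Finset ℕ)}
    (hN : N ⊆ (Finset.Icc 1 m).powersetCard d) {S : Finset ℕ} (hS : S ∈ N) :
    upWeight a m (N.erase S) + ∏ i ∈ S, a i ≤ upWeight a m N := by
  have hSN := Finset.mem_powersetCard.1 (hN hS)
  have hnot : S ∉ (Finset.Icc 1 m).powerset.filter fun R => ∃ T ∈ N.erase S, T ⊆ R := by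
    simp only [Finset.mem_filter, Finset.mem_erase, not_and, not_exists]
    rintro - T ⟨hne, hT⟩ hTS
    have hTN := Finset.mem_powersetCard.1 (hN hT)
    exact hne (Finset.eq_of_subset_of_card_le hTS (by omega))
  rw [upWeight, add_comm, ← Finset.sum_insert (f := fun R => ∏ i ∈ R, a i) hnot]
  refine Finset.sum_le_sum_of_subset fun R hR => ?_
  rcases Finset.mem_insert.1 hR with rfl | hR
  · exact Finset.mem_filter.2 ⟨Finset.mem_powerset.2 hSN.1, R, hS, subset_rfl⟩
  · obtain ⟨hR, T, hT, hTR⟩ := Finset.mem_filter.1 hR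
    exact Finset.mem_filter.2 ⟨hR, T, Finset.mem_of_mem_erase hT, hTR⟩

lemma prod_Icc_le_prod_of_card {a : ℕ → ℕ} {m : ℕ}
    (hmono : ∀ i j, 1 ≤ i → i ≤ j → j ≤ m → a i ≤ a j) {d : ℕ} {S : Finset ℕ}
    (hS : S ⊆ Finset.Icc 1 m) (hcard : S.card = d) :
    ∏ i ∈ Finset.Icc 1 d, a i ≤ ∏ i ∈ S, a i := by
  induction d generalizing S with
  | zero => simp [Finset.card_eq_zero.1 hcard]
  | succ d ih =>
    have hne : S.Nonempty := Finset.card_pos.1 (by omega)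
    have hmax := S.max'_mem hne
    have hle : d + 1 ≤ S.max' hne := by
      have : S ⊆ Finset.Icc 1 (S.max' hne) := fun x hx =>
        Finset.mem_Icc.2 ⟨(Finset.mem_Icc.1 (hS hx)).1, S.le_max' x hx⟩
      simpa [hcard] using Finset.card_le_card this
    rw [Finset.prod_Icc_succ_top (by omega), ← Finset.prod_erase_mul S a hmax]
    refine Nat.mul_le_mul (ih ((Finset.erase_subset _ _).trans hS) ?_)
      (hmono _ _ (by omega) hle (Finset.mem_Icc.1 (hS hmax)).2)
    rw [Finset.card_erase_of_mem hmax, hcard, Nat.add_sub_cancel]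

lemma prod_Icc_le_prod_Icc_succ {n : ℕ → ℕ} {m : ℕ}
    (hmono : ∀ i j, 1 ≤ i → i ≤ j → j ≤ m + 1 → n i ≤ n j) {k : ℕ} (hk : 1 ≤ k) :
    ∏ i ∈ Finset.Icc k m, n i ≤ ∏ i ∈ Finset.Icc (k + 1) (m + 1), n i := by
  rw [← Finset.map_add_right_Icc, Finset.prod_map]
  refine Finset.prod_le_prod' fun i hi => ?_
  have := Finset.mem_Icc.1 hi
  exact hmono _ _ (by omega) (by simp) (by simp; omega)

lemma prod_Icc_eq_mul {n : ℕ → ℕ} {m k : ℕ} (hk : k ≤ m) :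
    ∏ i ∈ Finset.Icc k m, n i = n k * ∏ i ∈ Finset.Icc (k + 1) m, n i := by
  rw [← Finset.insert_Icc_add_one_left_eq_Icc hk, Finset.prod_insert (by simp)]

lemma prod_Icc_anti {n : ℕ → ℕ} {m : ℕ} {k l : ℕ} (hkl : k ≤ l)
    (hn : ∀ i, k ≤ i → i ≤ m → 1 ≤ n i) :
    ∏ i ∈ Finset.Icc l m, n i ≤ ∏ i ∈ Finset.Icc k m, n i := by
  refine Finset.prod_le_prod_of_subset_of_one_le' (Finset.Icc_subset_Icc_left hkl) fun i hi _ => ?_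
  exact hn i (Finset.mem_Icc.1 hi).1 (Finset.mem_Icc.1 hi).2

lemma prod_Icc_add_prod_Icc_le {n : ℕ → ℕ} {m : ℕ} {k : ℕ}
    (hn : ∀ i, k ≤ i → i ≤ m → 2 ≤ n i) (s u : ℕ) (hsu : k + s + u ≤ m + 1) :
    ∏ i ∈ Finset.Icc (k + u) m, n i + ∏ i ∈ Finset.Icc (k + s) m, n i ≤
      ∏ i ∈ Finset.Icc k m, n i + ∏ i ∈ Finset.Icc (k + s + u) m, n i := by
  rcases Nat.eq_zero_or_pos s with rfl | hs
  · simp [add_comm]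
  rcases Nat.eq_zero_or_pos u with rfl | hu
  · simp
  have key : ∀ l, k + 1 ≤ l →
      2 * ∏ i ∈ Finset.Icc l m, n i ≤ ∏ i ∈ Finset.Icc k m, n i := fun l hl => by
    rw [prod_Icc_eq_mul (show k ≤ m by omega)]
    exact Nat.mul_le_mul (hn k le_rfl (by omega))
      (prod_Icc_anti hl fun i h1 h2 => by have := hn i (by omega) h2; omega)
  have h1 := key (k + u) (by omega)
  have h2 := key (k + s) (by omega)
  omega

/-- Among all families of `r` sets of size `d` in `{1, …, m}`, the up-closure has least weight for
the sets `{1, …, d - 1, j}` with `d ≤ j < d + r`. -/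
theorem le_upWeight_add {a : ℕ → ℕ} {m d r : ℕ} (ha : ∀ i, 1 ≤ i → i ≤ m → 1 ≤ a i)
    (hmono : ∀ i j, 1 ≤ i → i ≤ j → j ≤ m → a i ≤ a j) (hd : 1 ≤ d) (hr : d + r ≤ m + 1)
    {N : Finset (Finset ℕ)} (hN : N ⊆ (Finset.Icc 1 m).powersetCard d) (hNr : N.card = r) :
    (∏ i ∈ Finset.Icc 1 (d - 1), a i) * ∏ i ∈ Finset.Icc d m, (a i + 1) ≤
      upWeight a m N +
        (∏ i ∈ Finset.Icc 1 (d - 1), a i) * ∏ i ∈ Finset.Icc (d + r) m, (a i + 1) := by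
  induction m generalizing d r N with
  | zero =>
    obtain ⟨rfl, rfl⟩ : d = 1 ∧ r = 0 := by omega
    simp
  | succ m ih =>
    rcases Nat.eq_zero_or_pos r with rfl | hr0
    · simp
    replace ih := fun {d r} => @ih d r (fun i h1 h2 => ha i h1 (by omega))
      (fun i j h1 h2 h3 => hmono i j h1 h2 (by omega))
    set N₁ := N.filter fun T => m + 1 ∉ T with hN₁
    set L := (N.filter fun T => m + 1 ∈ T).image fun T => T.erase (m + 1) with hL
    have hN₁N : N₁ ⊆ N := Finset.filter_subset _ _
    have hN₁m : N₁ ⊆ (Finset.Icc 1 m).powersetCard d := fun T hT => by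
      obtain ⟨hT, hmT⟩ := Finset.mem_filter.1 hT
      obtain ⟨hT, hc⟩ := Finset.mem_powersetCard.1 (hN hT)
      refine Finset.mem_powersetCard.2 ⟨fun x hx => ?_, hc⟩
      have := Finset.mem_Icc.1 (hT hx)
      have : x ≠ m + 1 := fun h => hmT (h ▸ hx)
      exact Finset.mem_Icc.2 (by omega)
    have hN₁im : N₁ ⊆ N.image fun T => T.erase (m + 1) := fun T hT =>
      Finset.mem_image.2 ⟨T, hN₁N hT, Finset.erase_eq_of_notMem (Finset.mem_filter.1 hT).2⟩
    have hLim : L ⊆ N.image fun T => T.erase (m + 1) :=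
      Finset.image_subset_image (Finset.filter_subset _ _)
    have hLm : L ⊆ (Finset.Icc 1 m).powersetCard (d - 1) := fun T hT => by
      obtain ⟨T, hTN, rfl⟩ := Finset.mem_image.1 hT
      obtain ⟨hT, hmT⟩ := Finset.mem_filter.1 hTN
      obtain ⟨hT, hc⟩ := Finset.mem_powersetCard.1 (hN hT)
      refine Finset.mem_powersetCard.2 ⟨fun x hx => ?_, ?_⟩
      · obtain ⟨hne, hx⟩ := Finset.mem_erase.1 hx
        have := Finset.mem_Icc.1 (hT hx)
        exact Finset.mem_Icc.2 (by omega)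
      · rw [Finset.card_erase_of_mem hmT, hc]
    have hLcard : N₁.card + L.card = r := by
      rw [hL, Finset.card_image_of_injOn, ← hNr, add_comm]
      · exact Finset.card_filter_add_card_filter_not _
      · intro T hT T' hT' h
        simp only [Finset.coe_filter, Set.mem_ofPred_eq] at hT hT'
        rw [← Finset.insert_erase hT.2, ← Finset.insert_erase hT'.2]
        exact congrArg (insert (m + 1)) h
    have hW₁ := upWeight_mono a m hN₁N
    have hW₁' := upWeight_mono a m hN₁im
    have hW₂ := upWeight_mono a m hLim
    rw [upWeight_succ]
    rw [Finset.prod_Icc_succ_top (by omega : d ≤ m + 1)]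
    set b := a (m + 1)
    have hb : 1 ≤ b := ha _ (by omega) le_rfl
    set W := upWeight a m N
    set W' := upWeight a m (N.image fun T => T.erase (m + 1))
    have hshift : ∀ k, 1 ≤ k → ∏ i ∈ Finset.Icc k m, (a i + 1) ≤
        ∏ i ∈ Finset.Icc (k + 1) (m + 1), (a i + 1) := fun k hk =>
      prod_Icc_le_prod_Icc_succ (n := fun i => a i + 1)
        (fun i j h1 h2 h3 => Nat.succ_le_succ (hmono i j h1 h2 h3)) hk
    rcases Nat.eq_zero_or_pos L.card with ht | ht
    · rcases Nat.lt_or_ge m (d + r - 1) with hlt | hge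
      · have hpos : 0 < N₁.card := by omega
        obtain ⟨S, hS⟩ := Finset.card_pos.1 hpos
        have hSm := Finset.mem_powersetCard.1 (hN₁m hS)
        have hSa := prod_Icc_le_prod_of_card
          (fun i j h1 h2 h3 => hmono i j h1 h2 (by omega)) hSm.1 hSm.2
        have hE := upWeight_erase_add_le a hN₁m hS
        have hI := ih (d := d) (r := r - 1) hd (by omega)
          ((Finset.erase_subset S N₁).trans hN₁m)
          (by rw [Finset.card_erase_of_mem hS]; omega)
        have h1 : ∏ i ∈ Finset.Icc (d + (r - 1)) m, (a i + 1) = 1 := by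
          rw [Finset.Icc_eq_empty (by omega), Finset.prod_empty]
        have hdd : ∏ i ∈ Finset.Icc 1 d, a i = (∏ i ∈ Finset.Icc 1 (d - 1), a i) * a d := by
          obtain ⟨e, rfl⟩ : ∃ e, d = e + 1 := ⟨d - 1, by omega⟩
          rw [Finset.prod_Icc_succ_top (by omega), Nat.add_sub_cancel]
        have hda := ha d hd (by omega)
        rw [h1] at hI
        rw [hdd] at hSa
        generalize (∏ i ∈ Finset.Icc 1 (d - 1), a i) = α at *
        generalize (∏ i ∈ Finset.Icc d m, (a i + 1)) = P at *
        have h3 : α * 1 ≤ α * a d := Nat.mul_le_mul_left _ hda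
        have h4 : α * P ≤ W := by omega
        have h5 : α * P ≤ W' := by omega
        generalize (∏ i ∈ Finset.Icc (d + r) (m + 1), (a i + 1)) = Q at *
        nlinarith [Nat.zero_le (α * Q), Nat.mul_le_mul_left b h5]
      · have hI := ih (d := d) (r := r) hd (by omega) hN₁m (by omega)
        rw [Finset.prod_Icc_succ_top (by omega : d + r ≤ m + 1)]
        generalize (∏ i ∈ Finset.Icc 1 (d - 1), a i) = α at *
        generalize (∏ i ∈ Finset.Icc d m, (a i + 1)) = P at *
        generalize (∏ i ∈ Finset.Icc (d + r) m, (a i + 1)) = Q at *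
        have h4 : α * P ≤ W + α * Q := by omega
        have h5 : α * P ≤ W' + α * Q := by omega
        nlinarith [Nat.mul_le_mul_left b h5]
    · have hI := ih (d := d) (r := N₁.card) hd (by omega) hN₁m rfl
      rcases Nat.eq_or_lt_of_le hd with rfl | hd2
      · have hL0 : L ⊆ {∅} := by simpa using hLm
        have hL1 : L.card = 1 := le_antisymm (by simpa using Finset.card_le_card hL0) ht
        have hmem : ∅ ∈ L := by
          rw [Finset.eq_of_subset_of_card_le hL0 (by simp [hL1])]; simp
        have hW := upWeight_of_empty_mem a m hmem
        have hs := hshift (1 + N₁.card) (by omega)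
        rw [show 1 + N₁.card + 1 = 1 + r by omega] at hs
        simp only [Nat.sub_self, Finset.Icc_eq_empty (show ¬ 1 ≤ 0 by omega), Finset.prod_empty,
          one_mul] at hI ⊢
        have h5 := hW ▸ hW₂
        nlinarith [Nat.mul_le_mul_left b h5]
      · obtain ⟨e, rfl⟩ : ∃ e, d = e + 2 := ⟨d - 2, by omega⟩
        obtain ⟨u, hu⟩ : ∃ u, L.card = u + 1 := ⟨L.card - 1, by omega⟩
        have hI2 := ih (d := e + 1) (r := L.card) (by omega) (by omega) hLm rfl
        have hs := hshift (e + 2 + N₁.card + u) (by omega)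
        have hc := prod_Icc_add_prod_Icc_le (n := fun i => a i + 1) (m := m) (k := e + 2)
          (fun i h1 h2 => Nat.succ_le_succ (ha i (by omega) (by omega))) N₁.card u (by omega)
        have hPT := prod_Icc_anti (n := fun i => a i + 1) (m := m)
          (show e + 2 ≤ e + 2 + u by omega) (fun i _ _ => by omega)
        have hab : a (e + 1) ≤ b := hmono _ _ (by omega) (by omega) le_rfl
        rw [show e + 2 + N₁.card + u + 1 = e + 2 + r by omega] at hs
        rw [hu, show e + 1 + (u + 1) = e + 2 + u by ring,
          prod_Icc_eq_mul (show e + 1 ≤ m by omega)] at hI2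
        simp only [Nat.add_sub_cancel, show e + 2 - 1 = e + 1 by omega,
          Finset.prod_Icc_succ_top (show 1 ≤ e + 1 by omega)] at hI hI2 ⊢
        generalize (∏ i ∈ Finset.Icc 1 e, a i) = α at *
        generalize (∏ i ∈ Finset.Icc (e + 2) m, (a i + 1)) = P at *
        generalize (∏ i ∈ Finset.Icc (e + 2 + N₁.card) m, (a i + 1)) = Q at *
        generalize (∏ i ∈ Finset.Icc (e + 2 + u) m, (a i + 1)) = T at *
        generalize (∏ i ∈ Finset.Icc (e + 2 + r) (m + 1), (a i + 1)) = U at *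
        generalize (∏ i ∈ Finset.Icc (e + 2 + N₁.card + u) m, (a i + 1)) = U' at *
        generalize a (e + 1) = a' at *
        have hQ : Q + T ≤ P + U := by omega
        have hkey : b * T + a' * Q ≤ b * P + a' * U := by
          zify at *
          nlinarith [mul_nonneg (sub_nonneg.2 hab) (sub_nonneg.2 hPT),
            mul_le_mul_of_nonneg_left hQ (Int.natCast_nonneg a')]
        have hW₁2 : α * a' * P ≤ W + α * a' * Q := by omega
        have hW₂2 : α * ((a' + 1) * P) ≤ W' + α * T := by omega
        nlinarith [Nat.mul_le_mul_left b hW₂2, Nat.mul_le_mul_left α hkey]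

section InitialSubspace

variable {F ι : Type*} [Field F]

lemma mem_codeSupp [Fintype ι] {C : Submodule F (ι → F)} {x : ι} :
    x ∈ codeSupp C ↔ ∃ c ∈ C, c x ≠ 0 := by
  simp [codeSupp]

/-- The operator `f ↦ f - f ∘ z`. -/
def subComp (F : Type*) [Field F] (z : ι → ι) : (ι → F) →ₗ[F] (ι → F) :=
  LinearMap.id - LinearMap.funLeft F F z

lemma subComp_apply (z : ι → ι) (f : ι → F) (x : ι) : subComp F z f x = f x - f (z x) := rfl

lemma subComp_subComp {z : ι → ι} (hz : ∀ x, z (z x) = z x) (f : ι → F) :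
    subComp F z (subComp F z f) = subComp F z f := by
  ext x
  simp [subComp_apply, hz]

lemma subComp_comm {z z' : ι → ι} (h : ∀ x, z (z' x) = z' (z x)) (f : ι → F) :
    subComp F z (subComp F z' f) = subComp F z' (subComp F z f) := by
  ext x
  simp only [subComp_apply, h]
  ring

/-- The part of `V` invariant under `z` together with the image of `V` under `f ↦ f - f ∘ z`. -/
def initialSubspace (z : ι → ι) (V : Submodule F (ι → F)) : Submodule F (ι → F) :=
  (V ⊓ LinearMap.ker (subComp F z)) ⊔ V.map (subComp F z)

lemma mem_initialSubspace {z : ι → ι} {V : Submodule F (ι → F)} {f : ι → F} :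
    f ∈ initialSubspace z V ↔
      ∃ k ∈ V, subComp F z k = 0 ∧ ∃ v ∈ V, k + subComp F z v = f := by
  simp only [initialSubspace, Submodule.mem_sup, Submodule.mem_inf, LinearMap.mem_ker,
    Submodule.mem_map]
  constructor
  · rintro ⟨k, ⟨hk, hk0⟩, _, ⟨v, hv, rfl⟩, rfl⟩
    exact ⟨k, hk, hk0, v, hv, rfl⟩
  · rintro ⟨k, hk, hk0, v, hv, rfl⟩
    exact ⟨k, ⟨hk, hk0⟩, _, ⟨v, hv, rfl⟩, rfl⟩

lemma initialSubspace_le {z : ι → ι} {V C : Submodule F (ι → F)} (hVC : V ≤ C)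
    (hC : C ≤ C.comap (subComp F z)) : initialSubspace z V ≤ C :=
  sup_le (inf_le_left.trans hVC) (Submodule.map_le_iff_le_comap.2 (hVC.trans hC))

lemma initialSubspace_le_comap_self {z : ι → ι} (hz : ∀ x, z (z x) = z x)
    (V : Submodule F (ι → F)) :
    initialSubspace z V ≤ (initialSubspace z V).comap (subComp F z) := by
  intro f hf
  obtain ⟨k, hk, hk0, v, hv, rfl⟩ := mem_initialSubspace.1 hf
  refine mem_initialSubspace.2 ⟨0, V.zero_mem, map_zero _, v, hv, ?_⟩
  rw [map_add, hk0, subComp_subComp hz]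

lemma initialSubspace_le_comap {z z' : ι → ι} (h : ∀ x, z (z' x) = z' (z x))
    {V : Submodule F (ι → F)} (hV : V ≤ V.comap (subComp F z')) :
    initialSubspace z V ≤ (initialSubspace z V).comap (subComp F z') := by
  intro f hf
  obtain ⟨k, hk, hk0, v, hv, rfl⟩ := mem_initialSubspace.1 hf
  refine mem_initialSubspace.2 ⟨_, hV hk, ?_, _, hV hv, ?_⟩
  · rw [subComp_comm h, hk0, map_zero]
  · rw [map_add, subComp_comm h]

lemma finrank_initialSubspace [Finite ι] {z : ι → ι} (hz : ∀ x, z (z x) = z x)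
    (V : Submodule F (ι → F)) :
    Module.finrank F (initialSubspace z V) = Module.finrank F V := by
  have hdisj : (V ⊓ LinearMap.ker (subComp F z)) ⊓ V.map (subComp F z) = ⊥ := by
    rw [eq_bot_iff]
    rintro f ⟨⟨-, hf⟩, v, -, rfl⟩
    rwa [SetLike.mem_coe, LinearMap.mem_ker, subComp_subComp hz] at hf
  have h1 := Submodule.finrank_sup_add_finrank_inf_eq (V ⊓ LinearMap.ker (subComp F z))
    (V.map (subComp F z))
  have h2 := LinearMap.finrank_range_add_finrank_ker ((subComp F z).domRestrict V)
  rw [LinearMap.range_domRestrict, LinearMap.ker_domRestrict] at h2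
  have h3 := (Submodule.equivSubtypeMap V ((LinearMap.ker (subComp F z)).submoduleOf V)).finrank_eq
  rw [Submodule.submoduleOf, Submodule.map_comap_subtype] at h3
  rw [hdisj, finrank_bot, add_zero] at h1
  rw [initialSubspace, h1, ← h2, add_comm, ← h3]

open Classical in
lemma card_codeSupp_initialSubspace_le [Fintype ι] {z : ι → ι} (hz : ∀ x, z (z x) = z x)
    {V : Submodule F (ι → F)}
    (hV : ∀ v ∈ V, ∀ x x', z x = z x' → x ≠ x' → v x = 0 → v x' = 0 →
      ∀ y, z y = z x → v y = 0) :
    (codeSupp (initialSubspace z V)).card ≤ (codeSupp V).card := by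
  rw [Finset.card_eq_sum_card_fiberwise (f := z) (t := Finset.univ) (by simp),
    Finset.card_eq_sum_card_fiberwise (s := codeSupp V) (f := z) (t := Finset.univ) (by simp)]
  refine Finset.sum_le_sum fun y _ => ?_
  have hker : ∀ k, subComp F z k = 0 → ∀ x, k x = k (z x) := fun k hk x => by
    simpa [subComp_apply, sub_eq_zero] using congrFun hk x
  by_cases hK : ∃ k ∈ V, subComp F z k = 0 ∧ k y ≠ 0
  · obtain ⟨k, hk, hk0, hky⟩ := hK
    refine Finset.card_le_card fun x hx => ?_
    obtain ⟨-, rfl⟩ := Finset.mem_filter.1 hx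
    exact Finset.mem_filter.2 ⟨mem_codeSupp.2 ⟨k, hk, by rwa [hker k hk0 x]⟩, rfl⟩
  push Not at hK
  have hsub : ∀ x ∈ codeSupp (initialSubspace z V), z x = y → ∃ v ∈ V, v x ≠ v y := by
    intro x hx hxy
    obtain ⟨f, hf, hfx⟩ := mem_codeSupp.1 hx
    obtain ⟨k, hk, hk0, v, hv, rfl⟩ := mem_initialSubspace.1 hf
    refine ⟨v, hv, fun h => hfx ?_⟩
    rw [Pi.add_apply, subComp_apply, hker k hk0 x, hxy, hK k hk hk0, h, sub_self, add_zero]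
  rcases Finset.eq_empty_or_nonempty
    ((codeSupp (initialSubspace z V)).filter fun x => z x = y) with hE | ⟨x, hxy⟩
  · simp [hE]
  obtain ⟨hx, rfl⟩ := Finset.mem_filter.1 hxy
  obtain ⟨v, hv, hvx⟩ := hsub x hx rfl
  have hle1 : ((codeSupp (initialSubspace z V)).filter fun x' => z x' = z x) ⊆
      (Finset.univ.filter fun x' => z x' = z x).erase (z x) := fun x' hx' => by
    obtain ⟨hx', hxx'⟩ := Finset.mem_filter.1 hx'
    obtain ⟨w, -, hw⟩ := hsub x' hx' hxx'
    exact Finset.mem_erase.2 ⟨fun h => hw (by rw [h]),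
      Finset.mem_filter.2 ⟨Finset.mem_univ _, hxx'⟩⟩
  have hz0 : ((Finset.univ.filter fun x' => z x' = z x).filter fun x' => v x' = 0).card ≤ 1 := by
    refine Finset.card_le_one.2 fun p hp q hq => ?_
    simp only [Finset.mem_filter, Finset.mem_univ, true_and] at hp hq
    by_contra hpq
    have h0 := hV v hv p q (hp.1.trans hq.1.symm) hpq hp.2 hq.2
    exact hvx ((h0 x hp.1.symm).trans (h0 (z x) ((hz x).trans hp.1.symm)).symm)
  have hle2 : ((Finset.univ.filter fun x' => z x' = z x).filter fun x' => ¬ v x' = 0) ⊆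
      (codeSupp V).filter fun x' => z x' = z x := fun x' hx' => by
    simp only [Finset.mem_filter, Finset.mem_univ, true_and] at hx' ⊢
    exact ⟨mem_codeSupp.2 ⟨v, hv, hx'.2⟩, hx'.1⟩
  have h1 := Finset.card_le_card hle1
  rw [Finset.card_erase_of_mem (by simp [hz])] at h1
  have h2 := Finset.card_le_card hle2
  have h3 := Finset.card_filter_add_card_filter_not (s := Finset.univ.filter fun x' => z x' = z x)
    (fun x' => v x' = 0)
  omega

/-- A subspace can be made stable under commuting idempotent substitutions `f ↦ f ∘ z i`,
preserving its dimension and not increasing its support, if its elements vanish on every fibre of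
`z i` where they vanish twice. -/
lemma exists_stable_subspace {κ : Type*} [Fintype κ] [Fintype ι] {z : κ → ι → ι}
    (hz : ∀ i x, z i (z i x) = z i x) (hcomm : ∀ i j x, z i (z j x) = z j (z i x))
    {C : Submodule F (ι → F)} (hC : ∀ i, C ≤ C.comap (subComp F (z i)))
    (hfib : ∀ i, ∀ v ∈ C, ∀ x x', z i x = z i x' → x ≠ x' → v x = 0 → v x' = 0 →
      ∀ y, z i y = z i x → v y = 0) {V : Submodule F (ι → F)} (hVC : V ≤ C) :
    ∃ V' ≤ C, Module.finrank F V' = Module.finrank F V ∧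
      (codeSupp V').card ≤ (codeSupp V).card ∧ ∀ i, V' ≤ V'.comap (subComp F (z i)) := by
  classical
  suffices H : ∀ s : Finset κ, ∃ V' ≤ C, Module.finrank F V' = Module.finrank F V ∧
      (codeSupp V').card ≤ (codeSupp V).card ∧ ∀ i ∈ s, V' ≤ V'.comap (subComp F (z i)) by
    simpa using H Finset.univ
  intro s
  induction s using Finset.induction_on with
  | empty => exact ⟨V, hVC, rfl, le_rfl, by simp⟩
  | insert i s _ ih =>
    obtain ⟨V', hV'C, hr, hs, hst⟩ := ih
    refine ⟨initialSubspace (z i) V', initialSubspace_le hV'C (hC i),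
      (finrank_initialSubspace (hz i) V').trans hr,
      (card_codeSupp_initialSubspace_le (hz i) fun v hv => hfib i v (hV'C hv)).trans hs, ?_⟩
    intro j hj
    rcases Finset.mem_insert.1 hj with rfl | hj
    · exact initialSubspace_le_comap_self (hz _) V'
    · exact initialSubspace_le_comap (hcomm i j) (hst j hj)

end InitialSubspace

section CartesianCode

variable {F : Type*} {m : ℕ} {A : Fin m → Finset F}

/-- The embedding `i ↦ i + 1` of `Fin m` onto `{1, …, m}`. -/
def finSuccEmb (m : ℕ) : Fin m ↪ ℕ := ⟨fun i => i + 1, fun i j h => by simpa [Fin.ext_iff] using h⟩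

lemma finSuccEmb_apply (i : Fin m) : finSuccEmb m i = i + 1 := rfl

lemma map_finSuccEmb_univ (m : ℕ) : Finset.univ.map (finSuccEmb m) = Finset.Icc 1 m := by
  ext k
  simp only [Finset.mem_map, Finset.mem_univ, true_and, Finset.mem_Icc, finSuccEmb_apply]
  constructor
  · rintro ⟨i, rfl⟩
    omega
  · exact fun hk => ⟨⟨k - 1, by omega⟩, Nat.sub_add_cancel hk.1⟩

lemma nval_succ (A : Fin m → Finset F) (i : Fin m) : nval A (i + 1) = (A i).card := by
  simp [nval]

lemma prod_fin_eq_prod_Icc {M : Type*} [CommMonoid M] (m : ℕ) (f : ℕ → M) :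
    ∏ i : Fin m, f (i + 1) = ∏ k ∈ Finset.Icc 1 m, f k := by
  rw [← map_finSuccEmb_univ, Finset.prod_map]
  rfl

lemma prod_Icc_mul_prod_Icc {M : Type*} [CommMonoid M] (f : ℕ → M) {k l m : ℕ}
    (hl : 1 ≤ l) (hkl : k ≤ l) (hlm : l ≤ m + 1) :
    (∏ i ∈ Finset.Icc k (l - 1), f i) * ∏ i ∈ Finset.Icc l m, f i =
      ∏ i ∈ Finset.Icc k m, f i := by
  rw [← Finset.Ico_add_one_right_eq_Icc, ← Finset.Ico_add_one_right_eq_Icc,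
    ← Finset.Ico_add_one_right_eq_Icc, Nat.sub_add_cancel hl,
    Finset.prod_Ico_consecutive f hkl hlm]

variable [Field F]

/-- The evaluation of the square-free monomial `∏ x_k`, `k ∈ S`, variables being indexed from
`1`. -/
def sqfreeMonomial (A : Fin m → Finset F) (S : Finset ℕ) (P : {P : Fin m → F // ∀ i, P i ∈ A i}) :
    F :=
  ∏ i : Fin m, if (i : ℕ) + 1 ∈ S then P.1 i else 1

open Classical in
/-- The set of nonzero coordinates of a point, coordinates being indexed from `1`. -/
noncomputable def nonzeroCoords (P : {P : Fin m → F // ∀ i, P i ∈ A i}) : Finset ℕ :=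
  (Finset.univ.filter fun i => P.1 i ≠ 0).map (finSuccEmb m)

lemma succ_mem_nonzeroCoords {P : {P : Fin m → F // ∀ i, P i ∈ A i}} {i : Fin m} :
    (i : ℕ) + 1 ∈ nonzeroCoords P ↔ P.1 i ≠ 0 := by
  rw [nonzeroCoords, show (i : ℕ) + 1 = finSuccEmb m i from rfl, Finset.mem_map']
  simp

lemma nonzeroCoords_subset (P : {P : Fin m → F // ∀ i, P i ∈ A i}) :
    nonzeroCoords P ⊆ Finset.Icc 1 m := by
  rw [← map_finSuccEmb_univ]
  exact Finset.map_subset_map.2 (Finset.subset_univ _)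

lemma forall_mem_Icc_iff {p : ℕ → Prop} :
    (∀ k ∈ Finset.Icc 1 m, p k) ↔ ∀ i : Fin m, p (i + 1) := by
  rw [← map_finSuccEmb_univ, Finset.forall_mem_map]
  simp [finSuccEmb_apply]

lemma subset_nonzeroCoords_iff {S : Finset ℕ} (hS : S ⊆ Finset.Icc 1 m)
    {P : {P : Fin m → F // ∀ i, P i ∈ A i}} :
    S ⊆ nonzeroCoords P ↔ ∀ i : Fin m, (i : ℕ) + 1 ∈ S → P.1 i ≠ 0 := by
  simp only [← succ_mem_nonzeroCoords]
  rw [← forall_mem_Icc_iff (p := fun k => k ∈ S → k ∈ nonzeroCoords P)]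
  exact ⟨fun h k _ hk => h hk, fun h k hk => h k (hS hk) hk⟩

lemma disjoint_nonzeroCoords_iff {B : Finset ℕ} {P : {P : Fin m → F // ∀ i, P i ∈ A i}} :
    Disjoint (nonzeroCoords P) B ↔ ∀ i : Fin m, (i : ℕ) + 1 ∈ B → P.1 i = 0 := by
  rw [Finset.disjoint_right]
  constructor
  · exact fun h i hi => not_not.1 fun h0 => h hi (succ_mem_nonzeroCoords.2 h0)
  · intro h k hk hkP
    have := (forall_mem_Icc_iff (m := m) (p := fun k => k ∈ B → k ∉ nonzeroCoords P)).2
      (fun i hi hP => succ_mem_nonzeroCoords.1 hP (h i hi))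
    exact this k (nonzeroCoords_subset P hkP) hk hkP

lemma sqfreeMonomial_ne_zero_iff {S : Finset ℕ} (hS : S ⊆ Finset.Icc 1 m)
    {P : {P : Fin m → F // ∀ i, P i ∈ A i}} :
    sqfreeMonomial A S P ≠ 0 ↔ S ⊆ nonzeroCoords P := by
  rw [sqfreeMonomial, Finset.prod_ne_zero_iff, subset_nonzeroCoords_iff hS]
  refine forall_congr' fun i => ?_
  by_cases h : (i : ℕ) + 1 ∈ S <;> simp [h]

lemma evalCodeX_Sd_eq_span (A : Fin m → Finset F) (d : ℕ) :
    evalCodeX A (Sd m d) =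
      Submodule.span F (sqfreeMonomial A '' (Finset.Icc 1 m).powersetCard d) := by
  refine congrArg (Submodule.span F) (Set.Subset.antisymm ?_ ?_)
  · rintro _ ⟨a, ⟨ha, had⟩, rfl⟩
    have ha' : ∀ i, a i = if a i = 1 then 1 else 0 := fun i => by
      have := ha i
      split_ifs <;> omega
    refine ⟨(Finset.univ.filter fun i => a i = 1).map (finSuccEmb m), ?_, ?_⟩
    · rw [Finset.mem_coe, Finset.mem_powersetCard, Finset.card_map, Finset.card_filter,
        ← map_finSuccEmb_univ, ← had]
      exact ⟨Finset.map_subset_map.2 (Finset.filter_subset _ _),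
        Finset.sum_congr rfl fun i _ => (ha' i).symm⟩
    · ext P
      refine Finset.prod_congr rfl fun i _ => ?_
      have hmem : (i : ℕ) + 1 ∈ (Finset.univ.filter fun i => a i = 1).map (finSuccEmb m) ↔
          a i = 1 := by
        rw [← finSuccEmb_apply, Finset.mem_map']
        simp
      simp only [hmem]
      rcases Nat.le_one_iff_eq_zero_or_eq_one.1 (ha i) with h | h <;> simp [h]
  · rintro _ ⟨S, hS, rfl⟩
    obtain ⟨hS, hc⟩ := Finset.mem_powersetCard.1 hS
    refine ⟨fun i => if (i : ℕ) + 1 ∈ S then 1 else 0, ⟨fun i => ?_, ?_⟩, ?_⟩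
    · dsimp only
      split_ifs <;> omega
    · have h := Finset.sum_map Finset.univ (finSuccEmb m) fun k => if k ∈ S then 1 else 0
      rw [map_finSuccEmb_univ, Finset.sum_boole, Finset.filter_mem_eq_inter,
        Finset.inter_eq_right.2 hS] at h
      exact h.symm.trans hc
    · ext P
      refine Finset.prod_congr rfl fun i _ => ?_
      by_cases h : (i : ℕ) + 1 ∈ S <;> simp [h]

/-- The point obtained by replacing the `i`-th coordinate by zero. -/
def zeroCoord (h0 : ∀ i, (0 : F) ∈ A i) (i : Fin m) (P : {P : Fin m → F // ∀ i, P i ∈ A i}) :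
    {P : Fin m → F // ∀ i, P i ∈ A i} :=
  ⟨Function.update P.1 i 0, fun j => by
    by_cases h : j = i
    · subst h; simpa using h0 j
    · simpa [h] using P.2 j⟩

lemma zeroCoord_apply (h0 : ∀ i, (0 : F) ∈ A i) (i j : Fin m)
    (P : {P : Fin m → F // ∀ i, P i ∈ A i}) :
    (zeroCoord h0 i P).1 j = if j = i then 0 else P.1 j := by
  simp [zeroCoord, Function.update_apply]

lemma zeroCoord_comm (h0 : ∀ i, (0 : F) ∈ A i) (i j : Fin m)
    (P : {P : Fin m → F // ∀ i, P i ∈ A i}) :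
    zeroCoord h0 i (zeroCoord h0 j P) = zeroCoord h0 j (zeroCoord h0 i P) := by
  ext k
  simp only [zeroCoord_apply]
  split_ifs <;> rfl

lemma zeroCoord_zeroCoord (h0 : ∀ i, (0 : F) ∈ A i) (i : Fin m)
    (P : {P : Fin m → F // ∀ i, P i ∈ A i}) :
    zeroCoord h0 i (zeroCoord h0 i P) = zeroCoord h0 i P := by
  ext k
  simp only [zeroCoord_apply]
  split_ifs <;> rfl

lemma apply_eq_of_zeroCoord_eq {h0 : ∀ i, (0 : F) ∈ A i} {i : Fin m}
    {P Q : {P : Fin m → F // ∀ i, P i ∈ A i}} (h : zeroCoord h0 i P = zeroCoord h0 i Q)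
    {j : Fin m} (hj : j ≠ i) : P.1 j = Q.1 j := by
  simpa [zeroCoord_apply, hj] using congrFun (congrArg Subtype.val h) j

lemma subComp_zeroCoord_sqfreeMonomial (h0 : ∀ i, (0 : F) ∈ A i) (i : Fin m) (S : Finset ℕ) :
    subComp F (zeroCoord h0 i) (sqfreeMonomial A S) =
      if (i : ℕ) + 1 ∈ S then sqfreeMonomial A S else 0 := by
  ext P
  rw [subComp_apply]
  split_ifs with h
  · have : sqfreeMonomial A S (zeroCoord h0 i P) = 0 :=
      Finset.prod_eq_zero (Finset.mem_univ i) (by simp [h, zeroCoord_apply])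
    rw [this, sub_zero]
  · rw [Pi.zero_apply, sub_eq_zero]
    refine Finset.prod_congr rfl fun j _ => ?_
    rw [zeroCoord_apply]
    by_cases hj : j = i
    · rw [hj, if_neg h, if_neg h]
    · rw [if_neg hj]

lemma exists_affine_of_mem_evalCodeX {d : ℕ} (h0 : ∀ i, (0 : F) ∈ A i) (i : Fin m)
    {v : {P : Fin m → F // ∀ i, P i ∈ A i} → F} (hv : v ∈ evalCodeX A (Sd m d))
    (P : {P : Fin m → F // ∀ i, P i ∈ A i}) :
    ∃ b c : F, ∀ Q, zeroCoord h0 i Q = zeroCoord h0 i P → v Q = b + Q.1 i * c := by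
  rw [evalCodeX_Sd_eq_span] at hv
  induction hv using Submodule.span_induction with
  | mem v hv =>
    obtain ⟨S, -, rfl⟩ := hv
    by_cases h : (i : ℕ) + 1 ∈ S
    · refine ⟨0, ∏ j ∈ Finset.univ.erase i, if (j : ℕ) + 1 ∈ S then P.1 j else 1, fun Q hQ => ?_⟩
      rw [sqfreeMonomial, ← Finset.mul_prod_erase _ _ (Finset.mem_univ i), if_pos h, zero_add]
      congr 1
      refine Finset.prod_congr rfl fun j hj => ?_
      rw [apply_eq_of_zeroCoord_eq hQ (Finset.ne_of_mem_erase hj)]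
    · refine ⟨sqfreeMonomial A S P, 0, fun Q hQ => ?_⟩
      rw [mul_zero, add_zero]
      refine Finset.prod_congr rfl fun j _ => ?_
      by_cases hj : j = i
      · rw [hj, if_neg h, if_neg h]
      · rw [apply_eq_of_zeroCoord_eq hQ hj]
  | zero => exact ⟨0, 0, fun Q _ => by simp⟩
  | add v w _ _ hv hw =>
    obtain ⟨b, c, h⟩ := hv
    obtain ⟨b', c', h'⟩ := hw
    refine ⟨b + b', c + c', fun Q hQ => ?_⟩
    rw [Pi.add_apply, h Q hQ, h' Q hQ]
    ring
  | smul t v _ hv =>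
    obtain ⟨b, c, h⟩ := hv
    refine ⟨t * b, t * c, fun Q hQ => ?_⟩
    rw [Pi.smul_apply, h Q hQ, smul_eq_mul]
    ring

lemma eq_zero_on_fiber {d : ℕ} (h0 : ∀ i, (0 : F) ∈ A i) (i : Fin m)
    {v : {P : Fin m → F // ∀ i, P i ∈ A i} → F} (hv : v ∈ evalCodeX A (Sd m d))
    {P Q : {P : Fin m → F // ∀ i, P i ∈ A i}} (hPQ : zeroCoord h0 i P = zeroCoord h0 i Q)
    (hne : P ≠ Q) (hP : v P = 0) (hQ : v Q = 0) (R : {P : Fin m → F // ∀ i, P i ∈ A i})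
    (hR : zeroCoord h0 i R = zeroCoord h0 i P) : v R = 0 := by
  obtain ⟨b, c, h⟩ := exists_affine_of_mem_evalCodeX h0 i hv P
  have hi : P.1 i ≠ Q.1 i := fun hi => hne <| by
    ext j
    by_cases hj : j = i
    · rw [hj, hi]
    · exact apply_eq_of_zeroCoord_eq hPQ hj
  rw [h P rfl] at hP
  rw [h Q hPQ.symm] at hQ
  have hc : c = 0 := by
    have : (P.1 i - Q.1 i) * c = 0 := by linear_combination hP - hQ
    exact (mul_eq_zero.1 this).resolve_left (sub_ne_zero.2 hi)
  rw [h R hR]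
  rw [hc] at hP ⊢
  simpa using hP

/-- A subcode stable under zeroing coordinates is spanned by monomials. -/
lemma le_span_sqfreeMonomial {d : ℕ} (h0 : ∀ i, (0 : F) ∈ A i)
    {V : Submodule F ({P : Fin m → F // ∀ i, P i ∈ A i} → F)} (hV : V ≤ evalCodeX A (Sd m d))
    (hst : ∀ i, V ≤ V.comap (subComp F (zeroCoord h0 i))) :
    V ≤ Submodule.span F (sqfreeMonomial A ''
      {S | S ∈ (Finset.Icc 1 m).powersetCard d ∧ sqfreeMonomial A S ∈ V}) := by
  intro v hv
  have hvC := hV hv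
  rw [evalCodeX_Sd_eq_span, Submodule.mem_span_image_finset_iff_exists_fun] at hvC
  obtain ⟨c', hc'⟩ := hvC
  obtain ⟨c, rfl⟩ : ∃ c : Finset ℕ → F,
      ∑ T ∈ (Finset.Icc 1 m).powersetCard d, c T • sqfreeMonomial A T = v := by
    refine ⟨Function.extend Subtype.val c' 0, ?_⟩
    rw [← hc', ← Finset.sum_coe_sort]
    simp only [Subtype.val_injective.extend_apply]
  refine Submodule.sum_mem _ fun S hS => ?_
  by_cases hc : c S = 0
  · simp [hc]
  refine Submodule.smul_mem _ _ (Submodule.subset_span ⟨S, ⟨hS, ?_⟩, rfl⟩)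
  have key : ∀ t : Finset (Fin m), ∑ T ∈ (Finset.Icc 1 m).powersetCard d with
      ∀ i ∈ t, ((i : ℕ) + 1 ∈ T ↔ (i : ℕ) + 1 ∈ S), c T • sqfreeMonomial A T ∈ V := by
    intro t
    induction t using Finset.induction_on with
    | empty => simpa using hv
    | insert i t _ ih =>
      have hsub := hst i ih
      rw [Submodule.mem_comap, map_sum] at hsub
      simp only [map_smul, subComp_zeroCoord_sqfreeMonomial, smul_ite, smul_zero] at hsub
      rw [← Finset.sum_filter, Finset.filter_filter] at hsub
      simp only [Finset.forall_mem_insert, and_comm (a := (_ ↔ _))]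
      rw [← Finset.filter_filter]
      by_cases hi : (i : ℕ) + 1 ∈ S
      · simpa [hi, Finset.filter_filter] using hsub
      · have hdiff := V.sub_mem ih hsub
        rw [← Finset.filter_filter, ← Finset.sum_filter_add_sum_filter_not (Finset.filter _ _)
          (fun T => (i : ℕ) + 1 ∈ T), add_sub_cancel_left] at hdiff
        simpa [hi] using hdiff
  have huniv := key Finset.univ
  have hfilter : ((Finset.Icc 1 m).powersetCard d).filter (fun T =>
      ∀ i ∈ (Finset.univ : Finset (Fin m)), ((i : ℕ) + 1 ∈ T ↔ (i : ℕ) + 1 ∈ S)) = {S} := by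
    ext T
    simp only [Finset.mem_filter, Finset.mem_univ, true_implies, Finset.mem_singleton]
    constructor
    · rintro ⟨hT, h⟩
      have h' := (forall_mem_Icc_iff (p := fun k => k ∈ T ↔ k ∈ S)).2 h
      ext k
      exact ⟨fun hk => (h' k ((Finset.mem_powersetCard.1 hT).1 hk)).1 hk,
        fun hk => (h' k ((Finset.mem_powersetCard.1 hS).1 hk)).2 hk⟩
    · rintro rfl
      exact ⟨hS, fun _ => Iff.rfl⟩
  rw [hfilter, Finset.sum_singleton] at huniv
  exact (V.smul_mem_iff hc).1 huniv

lemma exists_nonzeroCoords_eq (hcard : ∀ i, 2 ≤ (A i).card) (h0 : ∀ i, (0 : F) ∈ A i)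
    {S : Finset ℕ} (hS : S ⊆ Finset.Icc 1 m) :
    ∃ P : {P : Fin m → F // ∀ i, P i ∈ A i}, nonzeroCoords P = S := by
  choose y hy hy0 using fun i => Finset.exists_mem_ne (hcard i) 0
  let P : {P : Fin m → F // ∀ i, P i ∈ A i} := ⟨fun i => if (i : ℕ) + 1 ∈ S then y i else 0,
    fun i => by dsimp only; split_ifs; exacts [hy i, h0 i]⟩
  have h : ∀ i : Fin m, (i : ℕ) + 1 ∈ nonzeroCoords P ↔ (i : ℕ) + 1 ∈ S := fun i => by
    rw [succ_mem_nonzeroCoords]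
    by_cases hi : (i : ℕ) + 1 ∈ S <;> simp [P, hi, hy0]
  have h' := (forall_mem_Icc_iff (p := fun k => k ∈ nonzeroCoords P ↔ k ∈ S)).2 h
  refine ⟨P, ?_⟩
  ext k
  exact ⟨fun hk => (h' k (nonzeroCoords_subset P hk)).1 hk, fun hk => (h' k (hS hk)).2 hk⟩

/-- An antichain of square-free monomials is linearly independent on a Cartesian set. -/
lemma linearIndependent_sqfreeMonomial (hcard : ∀ i, 2 ≤ (A i).card) (h0 : ∀ i, (0 : F) ∈ A i)
    {κ : Type*} {T : κ → Finset ℕ} (hT : ∀ k, T k ⊆ Finset.Icc 1 m)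
    (hanti : ∀ k l, T k ⊆ T l → k = l) :
    LinearIndependent F fun k => sqfreeMonomial A (T k) := by
  rw [linearIndependent_iff']
  intro s c hc l hl
  obtain ⟨P, hP⟩ := exists_nonzeroCoords_eq hcard h0 (hT l)
  have h := congrFun hc P
  rw [Finset.sum_apply, Finset.sum_eq_single_of_mem l hl] at h
  · refine (mul_eq_zero.1 h).resolve_right ?_
    exact (sqfreeMonomial_ne_zero_iff (hT l)).2 hP.ge
  · intro k _ hk
    have : sqfreeMonomial A (T k) P = 0 := not_not.1 fun h =>
      hk (hanti k l (((sqfreeMonomial_ne_zero_iff (hT k)).1 h).trans hP.le))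
    simp [this]

variable [Fintype F] [DecidableEq F]

lemma card_nonzeroCoords (h0 : ∀ i, (0 : F) ∈ A i) {S B : Finset ℕ} (hS : S ⊆ Finset.Icc 1 m)
    (hSB : Disjoint S B) :
    (Finset.univ.filter fun P : {P : Fin m → F // ∀ i, P i ∈ A i} =>
      S ⊆ nonzeroCoords P ∧ Disjoint (nonzeroCoords P) B).card =
      ∏ k ∈ Finset.Icc 1 m, if k ∈ S then nval A k - 1 else if k ∈ B then 1 else nval A k := by
  rw [← prod_fin_eq_prod_Icc]
  let A' : Fin m → Finset F := fun i =>
    if (i : ℕ) + 1 ∈ S then (A i).erase 0 else if (i : ℕ) + 1 ∈ B then {0} else A i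
  have hA' : (Finset.univ.filter fun P : {P : Fin m → F // ∀ i, P i ∈ A i} =>
      S ⊆ nonzeroCoords P ∧ Disjoint (nonzeroCoords P) B).map (Function.Embedding.subtype _) =
      Fintype.piFinset A' := by
    ext Q
    simp only [Finset.mem_map, Finset.mem_filter, Finset.mem_univ, true_and,
      subset_nonzeroCoords_iff hS, disjoint_nonzeroCoords_iff, Function.Embedding.subtype_apply,
      Subtype.exists, exists_and_left, exists_prop, exists_eq_right_right, Fintype.mem_piFinset]
    rw [← forall_and, ← forall_and]
    refine forall_congr' fun i => ?_
    have hdis : (i : ℕ) + 1 ∈ S → (i : ℕ) + 1 ∉ B := fun h => Finset.disjoint_left.1 hSB h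
    have h0i := h0 i
    by_cases h1 : (i : ℕ) + 1 ∈ S
    · simp [A', h1, hdis h1]
    · by_cases h2 : (i : ℕ) + 1 ∈ B
      · simp only [A', h1, h2, if_true, if_false, Finset.mem_singleton]
        exact ⟨fun h => h.1.2 trivial, fun h => by simp [h, h0i]⟩
      · simp [A', h1, h2]
  rw [← Finset.card_map, hA', Fintype.card_piFinset]
  refine Finset.prod_congr rfl fun i _ => ?_
  rw [nval_succ]
  dsimp only [A']
  split_ifs
  · rw [Finset.card_erase_of_mem (h0 i)]
  · simp
  · rfl

lemma card_exists_subset_nonzeroCoords (h0 : ∀ i, (0 : F) ∈ A i) (N : Finset (Finset ℕ)) :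
    (Finset.univ.filter fun P : {P : Fin m → F // ∀ i, P i ∈ A i} =>
      ∃ T ∈ N, T ⊆ nonzeroCoords P).card = upWeight (fun k => nval A k - 1) m N := by
  rw [upWeight, Finset.card_eq_sum_card_fiberwise (f := nonzeroCoords)
    (t := (Finset.Icc 1 m).powerset.filter fun R => ∃ T ∈ N, T ⊆ R)]
  · refine Finset.sum_congr rfl fun R hR => ?_
    obtain ⟨hR, hN⟩ := Finset.mem_filter.1 hR
    rw [Finset.mem_powerset] at hR
    have h := card_nonzeroCoords h0 (B := Finset.Icc 1 m \ R) hR Finset.disjoint_sdiff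
    have hprod : (∏ k ∈ Finset.Icc 1 m, if k ∈ R then nval A k - 1 else
        if k ∈ Finset.Icc 1 m \ R then 1 else nval A k) = ∏ k ∈ R, (nval A k - 1) := by
      rw [← Finset.prod_subset hR]
      · exact Finset.prod_congr rfl fun k hk => if_pos hk
      · intro k hk hkR
        rw [if_neg hkR, if_pos (Finset.mem_sdiff.2 ⟨hk, hkR⟩)]
    rw [← hprod, ← h, Finset.filter_filter]
    congr 1
    refine Finset.filter_congr fun P _ => ?_
    constructor
    · rintro ⟨-, rfl⟩
      exact ⟨subset_rfl, Finset.disjoint_sdiff⟩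
    · rintro ⟨h1, h2⟩
      have : nonzeroCoords P = R := Finset.Subset.antisymm (fun k hk => by
        by_contra hkR
        exact Finset.disjoint_left.1 h2 hk
          (Finset.mem_sdiff.2 ⟨nonzeroCoords_subset P hk, hkR⟩)) h1
      exact ⟨this ▸ hN, this⟩
  · intro P hP
    simp only [Finset.coe_filter, Finset.mem_univ, true_and, Set.mem_ofPred_eq,
      Finset.mem_powerset] at hP ⊢
    exact ⟨nonzeroCoords_subset P, hP⟩

/-- The support of a subcode of dimension `r` is at least as large as the up-closure of some family
of `r` square-free monomials. -/
lemma exists_upWeight_le_card_codeSupp {d : ℕ} (h0 : ∀ i, (0 : F) ∈ A i)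
    {V : Submodule F ({P : Fin m → F // ∀ i, P i ∈ A i} → F)} (hV : V ≤ evalCodeX A (Sd m d)) :
    ∃ N ⊆ (Finset.Icc 1 m).powersetCard d, N.card = Module.finrank F V ∧
      upWeight (fun k => nval A k - 1) m N ≤ (codeSupp V).card := by
  classical
  have hC : ∀ i, evalCodeX A (Sd m d) ≤
      (evalCodeX A (Sd m d)).comap (subComp F (zeroCoord h0 i)) := fun i => by
    rw [evalCodeX_Sd_eq_span, Submodule.span_le]
    rintro _ ⟨S, hS, rfl⟩
    rw [SetLike.mem_coe, Submodule.mem_comap, subComp_zeroCoord_sqfreeMonomial]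
    split_ifs
    · exact Submodule.subset_span ⟨S, hS, rfl⟩
    · exact Submodule.zero_mem _
  obtain ⟨V', hV'C, hr, hs, hst⟩ := exists_stable_subspace (zeroCoord_zeroCoord h0)
    (zeroCoord_comm h0) hC
    (fun i v hv P Q hPQ hne hP hQ R hR => eq_zero_on_fiber h0 i hv hPQ hne hP hQ R hR) hV
  have hle := le_span_sqfreeMonomial h0 hV'C hst
  set N := ((Finset.Icc 1 m).powersetCard d).filter fun S => sqfreeMonomial A S ∈ V'
  have hN : {S | S ∈ (Finset.Icc 1 m).powersetCard d ∧ sqfreeMonomial A S ∈ V'} = N := by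
    ext S
    simp [N]
  rw [hN, ← Finset.coe_image] at hle
  have hcard : Module.finrank F V ≤ N.card := by
    rw [← hr]
    exact (Submodule.finrank_mono hle).trans
      ((finrank_span_finset_le_card _).trans Finset.card_image_le)
  obtain ⟨N', hN', hN'c⟩ := Finset.exists_subset_card_eq hcard
  refine ⟨N', hN'.trans (Finset.filter_subset _ _), hN'c, le_trans ?_ hs⟩
  rw [← card_exists_subset_nonzeroCoords h0]
  refine Finset.card_le_card fun P hP => ?_
  obtain ⟨-, T, hT, hTP⟩ := Finset.mem_filter.1 hP
  obtain ⟨hT, hTV⟩ := Finset.mem_filter.1 (hN' hT)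
  exact mem_codeSupp.2
    ⟨_, hTV, (sqfreeMonomial_ne_zero_iff (Finset.mem_powersetCard.1 hT).1).2 hTP⟩

lemma exists_subcode_card_codeSupp (hcard : ∀ i, 2 ≤ (A i).card) (h0 : ∀ i, (0 : F) ∈ A i)
    {d r : ℕ} (hd : 1 ≤ d) (hr : d + r ≤ m + 1) :
    ∃ V ≤ evalCodeX A (Sd m d), Module.finrank F V = r ∧ (codeSupp V).card =
      (∏ i ∈ Finset.Icc 1 (d - 1), (nval A i - 1)) * (∏ i ∈ Finset.Icc (d + r) m, nval A i) *
        ((∏ i ∈ Finset.Icc d (d + r - 1), nval A i) - 1) := by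
  classical
  let T : Fin r → Finset ℕ := fun k => insert (d + k) (Finset.Icc 1 (d - 1))
  have hT : ∀ k, T k ⊆ Finset.Icc 1 m := fun k x hx => by
    simp only [T, Finset.mem_insert, Finset.mem_Icc] at hx ⊢
    omega
  have hanti : ∀ k l, T k ⊆ T l → k = l := fun k l h => by
    have := h (Finset.mem_insert_self _ _)
    simp only [T, Finset.mem_insert, Finset.mem_Icc] at this
    omega
  refine ⟨Submodule.span F (Set.range fun k => sqfreeMonomial A (T k)), ?_, ?_, ?_⟩
  · rw [evalCodeX_Sd_eq_span]
    refine Submodule.span_mono ?_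
    rintro _ ⟨k, rfl⟩
    refine ⟨T k, Finset.mem_coe.2 (Finset.mem_powersetCard.2 ⟨hT k, ?_⟩), rfl⟩
    rw [Finset.card_insert_of_notMem (by simp; omega), Nat.card_Icc]
    omega
  · rw [finrank_span_eq_card (linearIndependent_sqfreeMonomial hcard h0 hT hanti),
      Fintype.card_fin]
  have hsupp : codeSupp (Submodule.span F (Set.range fun k => sqfreeMonomial A (T k))) =
      (Finset.univ.filter fun P : {P : Fin m → F // ∀ i, P i ∈ A i} =>
        Finset.Icc 1 (d - 1) ⊆ nonzeroCoords P ∧ Disjoint (nonzeroCoords P) ∅) \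
      (Finset.univ.filter fun P : {P : Fin m → F // ∀ i, P i ∈ A i} =>
        Finset.Icc 1 (d - 1) ⊆ nonzeroCoords P ∧
          Disjoint (nonzeroCoords P) (Finset.Icc d (d + r - 1))) := by
    ext P
    have h1 : P ∈ codeSupp (Submodule.span F (Set.range fun k => sqfreeMonomial A (T k))) ↔
        ∃ k, T k ⊆ nonzeroCoords P := by
      simp only [← sqfreeMonomial_ne_zero_iff (hT _)]
      rw [mem_codeSupp]
      constructor
      · rintro ⟨c, hc, hcP⟩
        by_contra! hall
        refine hcP ?_
        have hker : Submodule.span F (Set.range fun k => sqfreeMonomial A (T k)) ≤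
            LinearMap.ker (LinearMap.proj (R := F) (φ := fun _ => F) P) := by
          rw [Submodule.span_le]
          rintro _ ⟨k, rfl⟩
          exact hall k
        exact hker hc
      · rintro ⟨k, hk⟩
        exact ⟨_, Submodule.subset_span ⟨k, rfl⟩, hk⟩
    rw [h1]
    simp only [T, Finset.insert_subset_iff, Finset.mem_sdiff, Finset.mem_filter, Finset.mem_univ,
      true_and, Finset.disjoint_empty_right, and_true, not_and, Finset.not_disjoint_iff,
      Finset.mem_Icc]
    constructor
    · rintro ⟨k, hk, hS⟩
      exact ⟨hS, fun _ => ⟨d + k, hk, by omega⟩⟩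
    · rintro ⟨hS, h⟩
      obtain ⟨x, hx, hxd⟩ := h hS
      exact ⟨⟨x - d, by omega⟩, by simpa [Nat.add_sub_cancel' hxd.1] using hx, hS⟩
  have hdisj : Disjoint (Finset.Icc 1 (d - 1)) (Finset.Icc d (d + r - 1)) := by
    rw [Finset.disjoint_left]
    intro x hx hx'
    rw [Finset.mem_Icc] at hx hx'
    omega
  have hsub : Finset.Icc 1 (d - 1) ⊆ Finset.Icc 1 m := Finset.Icc_subset_Icc_right (by omega)
  have hsplit : ∀ B : Finset ℕ, (∏ k ∈ Finset.Icc 1 m, if k ∈ Finset.Icc 1 (d - 1) then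
      nval A k - 1 else if k ∈ B then 1 else nval A k) =
      (∏ k ∈ Finset.Icc 1 (d - 1), (nval A k - 1)) *
        ((∏ k ∈ Finset.Icc d (d + r - 1), if k ∈ B then 1 else nval A k) *
          ∏ k ∈ Finset.Icc (d + r) m, if k ∈ B then 1 else nval A k) := fun B => by
    rw [prod_Icc_mul_prod_Icc _ (by omega) (by omega) hr,
      ← prod_Icc_mul_prod_Icc _ hd hd (by omega)]
    congr 1
    · exact Finset.prod_congr rfl fun k hk => if_pos hk
    · refine Finset.prod_congr rfl fun k hk => if_neg ?_
      rw [Finset.mem_Icc] at hk ⊢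
      omega
  rw [hsupp, Finset.card_sdiff_of_subset,
    card_nonzeroCoords h0 hsub (Finset.disjoint_empty_right _),
    card_nonzeroCoords h0 hsub hdisj, hsplit, hsplit]
  · have h1 : (∏ k ∈ Finset.Icc d (d + r - 1),
        if k ∈ Finset.Icc d (d + r - 1) then 1 else nval A k) = 1 :=
      Finset.prod_eq_one fun k hk => if_pos hk
    have h2 : (∏ k ∈ Finset.Icc (d + r) m,
        if k ∈ Finset.Icc d (d + r - 1) then 1 else nval A k) =
        ∏ k ∈ Finset.Icc (d + r) m, nval A k :=
      Finset.prod_congr rfl fun k hk => if_neg fun hk' => by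
        rw [Finset.mem_Icc] at hk hk'
        omega
    simp only [Finset.notMem_empty, if_false, h1, h2, ← Nat.mul_sub]
    rw [← Nat.sub_mul, mul_comm (_ - 1), ← mul_assoc]
  · intro P hP
    simp only [Finset.mem_filter, Finset.mem_univ, true_and, Finset.disjoint_empty_right,
      and_true] at hP ⊢
    exact hP.1

end CartesianCode

/-- Let `1 ≤ d ≤ m`, `1 ≤ r ≤ m+1−d`, let `X = A_1 × ⋯ × A_m` be a
Cartesian set with `0 ∈ A_i` for all `i`, and assume the growth condition
`n_{d+r−1}·n_{d−1}·(n_i+n_j−1) ≤ n_i·n_j·(n_{d+r−1}+n_{d−1}−1)` for all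
`d ≤ i < j ≤ d+r−2`. Then
`d_r(C_d^{X,S}) = ∏_{i=1}^{d−1}(n_i−1) · ∏_{i=d+r}^{m} n_i · (∏_{i=d}^{d+r−1} n_i − 1)`. -/
theorem ghw_cartesian_squarefree_homogeneous_formula
    {F : Type*} [Field F] [Fintype F] [DecidableEq F] {m d r : ℕ}
    (A : Fin m → Finset F)
    (hcard : ∀ i, 2 ≤ (A i).card)
    (hmono : ∀ i j : Fin m, i ≤ j → (A i).card ≤ (A j).card)
    (h0 : ∀ i, (0 : F) ∈ A i)
    (hd1 : 1 ≤ d) (hdm : d ≤ m) (hr1 : 1 ≤ r) (hr2 : r ≤ m + 1 - d)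
    (hcond : ∀ i j : ℕ, d ≤ i → i < j → j ≤ d + r - 2 →
      nval A (d + r - 1) * nval A (d - 1) * (nval A i + nval A j - 1) ≤
        nval A i * nval A j * (nval A (d + r - 1) + nval A (d - 1) - 1)) :
    GHW (evalCodeX A (Sd m d)) r =
      (∏ i ∈ Finset.Icc 1 (d - 1), (nval A i - 1)) *
        (∏ i ∈ Finset.Icc (d + r) m, nval A i) *
        ((∏ i ∈ Finset.Icc d (d + r - 1), nval A i) - 1) := by
  have hr : d + r ≤ m + 1 := by omega
  have hnval : ∀ k, 1 ≤ k → k ≤ m → 2 ≤ nval A k := fun k h1 h2 => by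
    rw [nval, dif_pos ⟨h1, h2⟩]
    exact hcard _
  have hnmono : ∀ i j, 1 ≤ i → i ≤ j → j ≤ m → nval A i ≤ nval A j := fun i j h1 h2 h3 => by
    rw [nval, nval, dif_pos ⟨h1, by omega⟩, dif_pos ⟨by omega, h3⟩]
    exact hmono _ _ (Fin.mk_le_mk.2 (by omega))
  obtain ⟨V, hVC, hVr, hVs⟩ := exists_subcode_card_codeSupp hcard h0 hd1 hr
  refine le_antisymm (Nat.sInf_le ⟨V, hVC, hVr, hVs⟩) (le_csInf ⟨_, V, hVC, hVr, hVs⟩ ?_)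
  rintro _ ⟨C', hC', hC'r, rfl⟩
  obtain ⟨N, hN, hNr, hNs⟩ := exists_upWeight_le_card_codeSupp h0 hC'
  have hW := le_upWeight_add (a := fun k => nval A k - 1) (m := m)
    (fun i h1 h2 => by have := hnval i h1 h2; omega)
    (fun i j h1 h2 h3 => Nat.sub_le_sub_right (hnmono i j h1 h2 h3) 1) hd1 hr hN (hNr.trans hC'r)
  have hadd : ∀ k, 1 ≤ k → ∏ i ∈ Finset.Icc k m, (nval A i - 1 + 1) =
      ∏ i ∈ Finset.Icc k m, nval A i := fun k hk => Finset.prod_congr rfl fun i hi => by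
    rw [Finset.mem_Icc] at hi
    have := hnval i (by omega) hi.2
    omega
  rw [hadd d hd1, hadd (d + r) (by omega), ← prod_Icc_mul_prod_Icc _ (by omega) (by omega) hr] at hW
  refine le_trans ?_ hNs
  rw [Nat.mul_sub, mul_one, Nat.sub_le_iff_le_add]
  refine le_trans (le_of_eq ?_) hW
  ring
end
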